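/- Let μ ∈ ℝ and let f : [0,∞) → ℝ be continuously differentiable with f and f' bounded and f(x) → 0 as x → ∞. Define u¹(t,x) = ∫₀^∞ f(y) G(t;x,y) dy for t > 0 and x ≥ 0. Then for every x > 0, the spatial derivative ∂_x u¹(t,x) converges to f'(x) as t ↓ 0. -/

import Mathlib

open MeasureTheory Set Filter

/-- Standard normal density. -/
noncomputable def phi (x : ℝ) : ℝ := (1 / Real.sqrt (2 * Real.pi)) * Real.exp (-x ^ 2 / 2)

/-- Standard normal tail function. -/
noncomputable def Psi (x : ℝ) : ℝ := ∫ y in Set.Ioi x, phi y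

/-- The kernel `G(t;x,y)` with drift parameter `μ`. -/
noncomputable def Gker (μ t x y : ℝ) : ℝ :=
  (1 / Real.sqrt t) *
      (Real.exp (2 * μ * y) * phi ((x + y + μ * t) / Real.sqrt t) +
        phi ((x - y + μ * t) / Real.sqrt t)) -
    2 * μ * Real.exp (2 * μ * y) * Psi ((x + y + μ * t) / Real.sqrt t)

/-- The kernel `H(t;x,y)` with parameters `μ, ν`. -/
noncomputable def Hker (μ ν t x y : ℝ) : ℝ :=
  if ν = μ then
    2 * Real.exp (2 * μ * y) *
      ((1 + μ * (x + y + μ * t)) * Psi ((x + y + μ * t) / Real.sqrt t) -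
        μ * Real.sqrt t * phi ((x + y + μ * t) / Real.sqrt t))
  else
    Real.exp (2 * μ * y) / (ν - μ) *
      ((2 * ν - μ) * Real.exp (2 * (ν - μ) * (x + y + ν * t)) *
          Psi ((x + y + (2 * ν - μ) * t) / Real.sqrt t) -
        μ * Psi ((x + y + μ * t) / Real.sqrt t))

/-- The density `g(t;b,s)` of `(B_t^{-μ}, S_t^{-μ})`, vanishing off `{b ≤ s, 0 ≤ s}`. -/
noncomputable def gker (μ t b s : ℝ) : ℝ :=
  if b ≤ s ∧ 0 ≤ s then
    Real.sqrt (2 / Real.pi) * t ^ (-(3 : ℝ) / 2) * (2 * s - b) *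
      Real.exp (-(2 * s - b) ^ 2 / (2 * t) - μ * (b + μ * t / 2))
  else 0

/-- Spatial derivative (one-sided at `x = 0`). -/
noncomputable def ux (u : ℝ → ℝ → ℝ) (t x : ℝ) : ℝ :=
  derivWithin (fun z => u t z) (Set.Ici 0) x

/-- Second spatial derivative (one-sided at `x = 0`). -/
noncomputable def uxx (u : ℝ → ℝ → ℝ) (t x : ℝ) : ℝ :=
  derivWithin (fun z => ux u t z) (Set.Ici 0) x

/-- Time derivative. -/
noncomputable def ut (u : ℝ → ℝ → ℝ) (t x : ℝ) : ℝ :=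
  deriv (fun s => u s x) t

/-- `u` is a solution of the Stroock–Williams problem with parameters `μ, ν`
and initial data `f`. -/
def IsSWSolution (μ ν : ℝ) (f : ℝ → ℝ) (u : ℝ → ℝ → ℝ) : Prop :=
  ContDiffOn ℝ (⊤ : ℕ∞) (fun p : ℝ × ℝ => u p.1 p.2) (Set.Ioi 0 ×ˢ Set.Ici 0) ∧
  (∀ T > (0 : ℝ),
    ContinuousOn (fun p : ℝ × ℝ => u p.1 p.2) (Set.Icc 0 T ×ˢ Set.Ici 0) ∧
    ContinuousOn (fun p : ℝ × ℝ => ux u p.1 p.2) (Set.Icc 0 T ×ˢ Set.Ici 0) ∧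
    ∃ C : ℝ, ∀ p ∈ Set.Icc (0 : ℝ) T ×ˢ Set.Ici (0 : ℝ),
      |u p.1 p.2| ≤ C ∧ |ux u p.1 p.2| ≤ C) ∧
  (∀ t > (0 : ℝ), Filter.Tendsto (fun x => u t x) Filter.atTop (nhds 0)) ∧
  (∀ t > (0 : ℝ), ∀ x ≥ (0 : ℝ), ut u t x = μ * ux u t x + (1 / 2) * uxx u t x) ∧
  (∀ x ≥ (0 : ℝ), u 0 x = f x) ∧
  (∀ t > (0 : ℝ), ut u t 0 = ν * ux u t 0)

/-- `f` is admissible initial data: `C¹` on `[0,∞)` with `f` and `f'` bounded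
and `f(x) → 0` as `x → ∞`. -/
def IsInitialData (f : ℝ → ℝ) : Prop :=
  ContDiffOn ℝ 1 f (Set.Ici 0) ∧
  (∃ C : ℝ, ∀ x ∈ Set.Ici (0 : ℝ), |f x| ≤ C ∧ |derivWithin f (Set.Ici 0) x| ≤ C) ∧
  Filter.Tendsto f Filter.atTop (nhds 0)

lemma phi_eq_gaussianPDFReal : phi = ProbabilityTheory.gaussianPDFReal 0 1 := by
  funext x
  simp [phi, ProbabilityTheory.gaussianPDFReal]

lemma integrable_phi : Integrable phi :=
  phi_eq_gaussianPDFReal ▸ ProbabilityTheory.integrable_gaussianPDFReal 0 1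

lemma integral_phi : ∫ x, phi x = 1 :=
  phi_eq_gaussianPDFReal ▸ ProbabilityTheory.integral_gaussianPDFReal_eq_one 0 one_ne_zero

lemma phi_nonneg (x : ℝ) : 0 ≤ phi x := by
  unfold phi
  positivity

lemma phi_neg (x : ℝ) : phi (-x) = phi x := by
  simp [phi]

lemma continuous_phi : Continuous phi := by
  unfold phi
  fun_prop

lemma phi_le_exp (l z : ℝ) : phi z ≤ Real.exp (-l * z + l ^ 2 / 2) := by
  have h1 : 1 / Real.sqrt (2 * Real.pi) ≤ 1 := by
    rw [div_le_one (by positivity)]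
    exact Real.one_le_sqrt.2 (by linarith [Real.pi_gt_three])
  calc phi z ≤ 1 * Real.exp (-z ^ 2 / 2) := by
        unfold phi
        gcongr
    _ ≤ _ := by
        rw [one_mul]
        exact Real.exp_le_exp.2 (by nlinarith [sq_nonneg (z - l)])

lemma Psi_nonneg (x : ℝ) : 0 ≤ Psi x :=
  setIntegral_nonneg measurableSet_Ioi fun y _ => phi_nonneg y

lemma Psi_neg_add (x : ℝ) : Psi (-x) + Psi x = 1 := by
  have h : Psi (-x) = ∫ y in Iic x, phi y := by
    simpa [Psi, phi_neg] using (integral_comp_neg_Iic x phi).symm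
  rw [h, Psi, intervalIntegral.integral_Iic_add_Ioi integrable_phi.integrableOn
    integrable_phi.integrableOn, integral_phi]

lemma hasDerivAt_Psi (x : ℝ) : HasDerivAt Psi (-phi x) x := by
  have h : Psi = fun z => Psi 0 - ∫ y in (0 : ℝ)..z, phi y := by
    funext z
    have := intervalIntegral.integral_interval_add_Ioi (a := 0) (b := z)
      integrable_phi.integrableOn integrable_phi.integrableOn
    simp only [Psi]
    linarith
  rw [h]
  exact (intervalIntegral.integral_hasDerivAt_right integrable_phi.intervalIntegrable
    continuous_phi.stronglyMeasurable.stronglyMeasurableAtFilter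
    continuous_phi.continuousAt).const_sub _

lemma continuous_Psi : Continuous Psi :=
  continuous_iff_continuousAt.2 fun x => (hasDerivAt_Psi x).continuousAt

/-- Chernoff bound for the normal tail. -/
lemma Psi_le_exp {l : ℝ} (hl : 0 ≤ l) (z : ℝ) : Psi z ≤ Real.exp (-l * z + l ^ 2 / 2) := by
  have hint : Integrable fun y => Real.exp (-l * z + l ^ 2 / 2) * phi (y - l) :=
    (integrable_phi.comp_sub_right l).const_mul _
  calc Psi z ≤ ∫ y in Ioi z, Real.exp (-l * z + l ^ 2 / 2) * phi (y - l) := by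
        refine setIntegral_mono_on integrable_phi.integrableOn hint.integrableOn
          measurableSet_Ioi fun y hy => ?_
        have hy : z < y := hy
        rw [phi, phi, mul_left_comm, ← Real.exp_add]
        gcongr
        nlinarith
    _ ≤ ∫ y, Real.exp (-l * z + l ^ 2 / 2) * phi (y - l) :=
        setIntegral_le_integral hint (ae_of_all _ fun y =>
          mul_nonneg (Real.exp_pos _).le (phi_nonneg _))
    _ = _ := by
        rw [integral_const_mul, integral_sub_right_eq_self phi l, integral_phi, mul_one]

/-- Nonnegative continuous functions satisfying the Gaussian Chernoff bounds. -/
structure HasChernoffBound (p : ℝ → ℝ) : Prop where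
  continuous : Continuous p
  nonneg : ∀ z, 0 ≤ p z
  le_exp : ∀ l : ℝ, 0 ≤ l → ∀ z, p z ≤ Real.exp (-l * z + l ^ 2 / 2)

lemma hasChernoffBound_phi : HasChernoffBound phi :=
  ⟨continuous_phi, phi_nonneg, fun l _ z => phi_le_exp l z⟩

lemma hasChernoffBound_Psi : HasChernoffBound Psi :=
  ⟨continuous_Psi, Psi_nonneg, fun _ hl z => Psi_le_exp hl z⟩

lemma HasChernoffBound.exists_weighted_bound {p : ℝ → ℝ} (hp : HasChernoffBound p) {s : ℝ}
    (hs : 0 < s) (c M : ℝ) : ∃ C, ∀ a, |a| ≤ M → ∀ y, 0 ≤ y →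
      |Real.exp (c * y) * p ((a + y) / s)| ≤ C * Real.exp (-y) := by
  set l := (|c| + 1) * s with hl
  refine ⟨Real.exp ((|c| + 1) * M + l ^ 2 / 2), fun a ha y hy => ?_⟩
  rw [abs_of_nonneg (mul_nonneg (Real.exp_pos _).le (hp.nonneg _)), ← Real.exp_add]
  calc Real.exp (c * y) * p ((a + y) / s)
      ≤ Real.exp (c * y) * Real.exp (-l * ((a + y) / s) + l ^ 2 / 2) := by
        gcongr
        exact hp.le_exp l (by positivity) _
    _ ≤ _ := by
        rw [← Real.exp_add]
        refine Real.exp_le_exp.2 ?_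
        have h1 : -l * ((a + y) / s) = -(|c| + 1) * (a + y) := by
          rw [hl]
          field_simp
        rw [h1]
        nlinarith [le_abs_self c, abs_nonneg c, neg_abs_le a,
          mul_nonneg (sub_nonneg.2 (le_abs_self c)) hy,
          mul_nonneg (add_nonneg (abs_nonneg c) zero_le_one)
            (by linarith [neg_abs_le a] : 0 ≤ a + M)]

lemma HasChernoffBound.integrableOn_mul {p h : ℝ → ℝ} (hp : HasChernoffBound p)
    (hc : ContinuousOn h (Ici 0)) {D : ℝ} (hD : ∀ y ∈ Ici (0 : ℝ), |h y| ≤ D) {s : ℝ}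
    (hs : 0 < s) (c a : ℝ) :
    IntegrableOn (fun y => h y * (Real.exp (c * y) * p ((a + y) / s))) (Ioi 0) := by
  obtain ⟨C, hC⟩ := hp.exists_weighted_bound hs c |a|
  have hcont : Continuous fun y => Real.exp (c * y) * p ((a + y) / s) := by
    have := hp.continuous
    fun_prop
  refine Integrable.mono' (((integrableOn_exp_neg_Ioi 0).const_mul C).const_mul D)
    (((hc.mono Ioi_subset_Ici_self).mul hcont.continuousOn).aestronglyMeasurable
      measurableSet_Ioi) ?_
  refine (ae_restrict_iff' measurableSet_Ioi).2 (ae_of_all _ fun y hy => ?_)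
  have hy : 0 < y := hy
  rw [norm_mul, Real.norm_eq_abs, Real.norm_eq_abs]
  exact mul_le_mul (hD y hy.le) (hC a le_rfl y hy.le) (abs_nonneg _)
    ((abs_nonneg _).trans (hD y hy.le))

/-- The survival function `∫_y^∞ G(t;x,z) dz` of the kernel `G(t;x,·)`. -/
noncomputable def survG (μ t x y : ℝ) : ℝ :=
  Psi ((y - x - μ * t) / Real.sqrt t) +
    Real.exp (2 * μ * y) * Psi ((x + y + μ * t) / Real.sqrt t)

/-- The transition density of Brownian motion with drift `μ` killed at `0`. -/
noncomputable def killedKer (μ t x y : ℝ) : ℝ :=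
  (1 / Real.sqrt t) * (phi ((x - y + μ * t) / Real.sqrt t) -
    Real.exp (2 * μ * y) * phi ((x + y + μ * t) / Real.sqrt t))

lemma hasDerivAt_survG_right (μ t x y : ℝ) :
    HasDerivAt (survG μ t x) (-Gker μ t x y) y := by
  have h1 : HasDerivAt (fun y => (y - x - μ * t) / Real.sqrt t) (1 / Real.sqrt t) y :=
    (((hasDerivAt_id y).sub_const x).sub_const (μ * t)).div_const _
  have h2 : HasDerivAt (fun y => (x + y + μ * t) / Real.sqrt t) (1 / Real.sqrt t) y :=
    (((hasDerivAt_id y).const_add x).add_const (μ * t)).div_const _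
  have h3 : HasDerivAt (fun y => Real.exp (2 * μ * y)) (Real.exp (2 * μ * y) * (2 * μ)) y := by
    simpa using ((hasDerivAt_id y).const_mul (2 * μ)).exp
  refine (((hasDerivAt_Psi _).comp y h1).add (h3.mul ((hasDerivAt_Psi _).comp y h2))).congr_deriv ?_
  have h4 : phi ((x - y + μ * t) / Real.sqrt t) = phi ((y - x - μ * t) / Real.sqrt t) := by
    rw [← phi_neg]
    congr 1
    ring
  simp only [Gker, h4, Function.comp]
  ring

lemma hasDerivAt_survG_left (μ t x y : ℝ) :
    HasDerivAt (fun x => survG μ t x y) (killedKer μ t x y) x := by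
  have h1 : HasDerivAt (fun x => (y - x - μ * t) / Real.sqrt t) (-1 / Real.sqrt t) x :=
    (((hasDerivAt_id x).const_sub y).sub_const (μ * t)).div_const _
  have h2 : HasDerivAt (fun x => (x + y + μ * t) / Real.sqrt t) (1 / Real.sqrt t) x :=
    (((hasDerivAt_id x).add_const y).add_const (μ * t)).div_const _
  refine (((hasDerivAt_Psi _).comp x h1).add
    (((hasDerivAt_Psi _).comp x h2).const_mul (Real.exp (2 * μ * y)))).congr_deriv ?_
  have h4 : phi ((x - y + μ * t) / Real.sqrt t) = phi ((y - x - μ * t) / Real.sqrt t) := by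
    rw [← phi_neg]
    congr 1
    ring
  simp only [killedKer, h4]
  ring

lemma survG_zero (μ t x : ℝ) : survG μ t x 0 = 1 := by
  rw [← Psi_neg_add ((x + μ * t) / Real.sqrt t), survG]
  simp only [mul_zero, Real.exp_zero, one_mul, add_zero]
  congr 2
  ring

lemma survG_eq (μ t x y : ℝ) : survG μ t x y =
    Real.exp (0 * y) * Psi ((-x - μ * t + y) / Real.sqrt t) +
      Real.exp (2 * μ * y) * Psi ((x + μ * t + y) / Real.sqrt t) := by
  rw [survG, zero_mul, Real.exp_zero, one_mul]
  congr 3 <;> ring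

lemma killedKer_eq (μ t x y : ℝ) : killedKer μ t x y =
    (1 / Real.sqrt t) * (Real.exp (0 * y) * phi ((-x - μ * t + y) / Real.sqrt t) -
      Real.exp (2 * μ * y) * phi ((x + μ * t + y) / Real.sqrt t)) := by
  rw [killedKer, ← phi_neg, zero_mul, Real.exp_zero, one_mul]
  congr 4 <;> ring

lemma Gker_eq (μ t x y : ℝ) : Gker μ t x y =
    (1 / Real.sqrt t) * (Real.exp (2 * μ * y) * phi ((x + μ * t + y) / Real.sqrt t) +
      Real.exp (0 * y) * phi ((-x - μ * t + y) / Real.sqrt t)) -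
    2 * μ * (Real.exp (2 * μ * y) * Psi ((x + μ * t + y) / Real.sqrt t)) := by
  rw [Gker, ← phi_neg ((x - y + μ * t) / Real.sqrt t), zero_mul, Real.exp_zero, one_mul,
    mul_assoc (2 * μ)]
  congr 5 <;> ring

lemma integrableOn_mul_survG {h : ℝ → ℝ} (hc : ContinuousOn h (Ici 0)) {D : ℝ}
    (hD : ∀ y ∈ Ici (0 : ℝ), |h y| ≤ D) (μ : ℝ) {t : ℝ} (ht : 0 < t) (x : ℝ) :
    IntegrableOn (fun y => h y * survG μ t x y) (Ioi 0) := by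
  have hs := Real.sqrt_pos.2 ht
  refine ((hasChernoffBound_Psi.integrableOn_mul hc hD hs 0 (-x - μ * t)).add
    (hasChernoffBound_Psi.integrableOn_mul hc hD hs (2 * μ) (x + μ * t))).congr_fun
    (fun y _ => ?_) measurableSet_Ioi
  simp only [survG_eq, Pi.add_apply]
  ring

lemma integrableOn_mul_killedKer {h : ℝ → ℝ} (hc : ContinuousOn h (Ici 0)) {D : ℝ}
    (hD : ∀ y ∈ Ici (0 : ℝ), |h y| ≤ D) (μ : ℝ) {t : ℝ} (ht : 0 < t) (x : ℝ) :
    IntegrableOn (fun y => h y * killedKer μ t x y) (Ioi 0) := by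
  have hs := Real.sqrt_pos.2 ht
  refine (((hasChernoffBound_phi.integrableOn_mul hc hD hs 0 (-x - μ * t)).sub
    (hasChernoffBound_phi.integrableOn_mul hc hD hs (2 * μ) (x + μ * t))).const_mul
    (1 / Real.sqrt t)).congr (ae_of_all _ fun y => ?_)
  simp only [killedKer_eq, Pi.sub_apply]
  ring

lemma integrableOn_mul_Gker {h : ℝ → ℝ} (hc : ContinuousOn h (Ici 0)) {D : ℝ}
    (hD : ∀ y ∈ Ici (0 : ℝ), |h y| ≤ D) (μ : ℝ) {t : ℝ} (ht : 0 < t) (x : ℝ) :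
    IntegrableOn (fun y => h y * Gker μ t x y) (Ioi 0) := by
  have hs := Real.sqrt_pos.2 ht
  refine ((((hasChernoffBound_phi.integrableOn_mul hc hD hs (2 * μ) (x + μ * t)).add
    (hasChernoffBound_phi.integrableOn_mul hc hD hs 0 (-x - μ * t))).const_mul
    (1 / Real.sqrt t)).sub ((hasChernoffBound_Psi.integrableOn_mul hc hD hs (2 * μ)
    (x + μ * t)).const_mul (2 * μ))).congr (ae_of_all _ fun y => ?_)
  simp only [Gker_eq, Pi.sub_apply, Pi.add_apply]
  ring

lemma tendsto_survG_atTop (μ : ℝ) {t : ℝ} (ht : 0 < t) (x : ℝ) :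
    Tendsto (survG μ t x) atTop (nhds 0) := by
  have key : ∀ c a : ℝ, Tendsto (fun y => Real.exp (c * y) * Psi ((a + y) / Real.sqrt t))
      atTop (nhds 0) := fun c a => by
    obtain ⟨C, hC⟩ := hasChernoffBound_Psi.exists_weighted_bound (Real.sqrt_pos.2 ht) c |a|
    refine squeeze_zero_norm' (a := fun y => C * Real.exp (-y)) ?_ ?_
    · filter_upwards [eventually_ge_atTop 0] with y hy using hC a le_rfl y hy
    · simpa using (Real.tendsto_exp_neg_atTop_nhds_zero).const_mul C
  have := (key 0 (-x - μ * t)).add (key (2 * μ) (x + μ * t))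
  rw [add_zero] at this
  exact this.congr fun y => (survG_eq μ t x y).symm

/-- Differentiation under the integral sign for the survival function. -/
lemma hasDerivAt_integral_mul_survG {h : ℝ → ℝ} (hc : ContinuousOn h (Ici 0)) {D : ℝ}
    (hD : ∀ y ∈ Ici (0 : ℝ), |h y| ≤ D) (μ : ℝ) {t : ℝ} (ht : 0 < t) (x : ℝ) :
    HasDerivAt (fun x => ∫ y in Ioi 0, h y * survG μ t x y)
      (∫ y in Ioi 0, h y * killedKer μ t x y) x := by
  have hs := Real.sqrt_pos.2 ht
  obtain ⟨C₁, hC₁⟩ := hasChernoffBound_phi.exists_weighted_bound hs 0 (|x| + 1 + |μ * t|)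
  obtain ⟨C₂, hC₂⟩ := hasChernoffBound_phi.exists_weighted_bound hs (2 * μ) (|x| + 1 + |μ * t|)
  refine (hasDerivAt_integral_of_dominated_loc_of_deriv_le
    (F' := fun x y => h y * killedKer μ t x y)
    (bound := fun y => D * ((1 / Real.sqrt t) * (C₁ + C₂) * Real.exp (-y)))
    (Metric.ball_mem_nhds x one_pos)
    (Eventually.of_forall fun x => (integrableOn_mul_survG hc hD μ ht x).aestronglyMeasurable)
    (integrableOn_mul_survG hc hD μ ht x)
    (integrableOn_mul_killedKer hc hD μ ht x).aestronglyMeasurable ?_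
    (((integrableOn_exp_neg_Ioi 0).const_mul _).const_mul D) ?_).2
  · refine (ae_restrict_iff' measurableSet_Ioi).2 (ae_of_all _ fun y hy z hz => ?_)
    have hy : 0 ≤ y := le_of_lt hy
    have hz : |z| ≤ |x| + 1 := by
      have h1 : |z - x| < 1 := by simpa [Real.dist_eq] using hz
      have h2 := abs_add_le (z - x) x
      rw [sub_add_cancel] at h2
      linarith
    have h1 := hC₁ (-z - μ * t) (by
      have := norm_sub_le (-z) (μ * t)
      simp only [Real.norm_eq_abs, abs_neg] at this
      linarith) y hy
    have h2 := hC₂ (z + μ * t) (by linarith [abs_add_le z (μ * t)]) y hy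
    rw [norm_mul, Real.norm_eq_abs, Real.norm_eq_abs]
    refine mul_le_mul (hD y hy) ?_ (abs_nonneg _) ((abs_nonneg _).trans (hD y hy))
    rw [killedKer_eq, abs_mul, abs_of_pos (one_div_pos.2 hs), mul_assoc (1 / Real.sqrt t)]
    refine mul_le_mul_of_nonneg_left ?_ (one_div_pos.2 hs).le
    rw [abs_le] at h1 h2 ⊢
    constructor <;> linarith
  · exact ae_of_all _ fun y z _ => (hasDerivAt_survG_left μ t z y).const_mul (h y)

/-- Integration by parts turns `u¹` into an integral of `f'` against the survival function. -/
lemma integral_mul_Gker {f g : ℝ → ℝ} (hfc : ContinuousOn f (Ici 0))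
    (hgc : ContinuousOn g (Ici 0)) (hfg : ∀ y ∈ Ioi (0 : ℝ), HasDerivAt f (g y) y) {D : ℝ}
    (hf : ∀ y ∈ Ici (0 : ℝ), |f y| ≤ D) (hg : ∀ y ∈ Ici (0 : ℝ), |g y| ≤ D)
    (h0 : Tendsto f atTop (nhds 0)) (μ : ℝ) {t : ℝ} (ht : 0 < t) (x : ℝ) :
    ∫ y in Ioi 0, f y * Gker μ t x y = f 0 + ∫ y in Ioi 0, g y * survG μ t x y := by
  have hcont : Tendsto (f * survG μ t x) (nhdsWithin 0 (Ioi 0)) (nhds (f 0 * 1)) := by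
    rw [← survG_zero μ t x]
    exact ((hfc 0 self_mem_Ici).mono Ioi_subset_Ici_self).mul
      (hasDerivAt_survG_right μ t x 0).continuousAt.continuousWithinAt
  have hinf : Tendsto (f * survG μ t x) atTop (nhds (0 * 0)) :=
    h0.mul (tendsto_survG_atTop μ ht x)
  have hG : IntegrableOn (f * fun y => -Gker μ t x y) (Ioi 0) :=
    (integrableOn_mul_Gker hfc hf μ ht x).neg.congr_fun
      (fun y _ => by simp) measurableSet_Ioi
  have := integral_Ioi_mul_deriv_eq_deriv_mul hfg
    (fun y _ => hasDerivAt_survG_right μ t x y) hG (integrableOn_mul_survG hgc hg μ ht x)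
    hcont hinf
  simp only [mul_neg, integral_neg] at this
  linarith

/-- Gaussian averages around a point converge to the value there. -/
lemma tendsto_integral_gaussian {g : ℝ → ℝ} (hg : Measurable g) {D : ℝ} (hD : ∀ y, |g y| ≤ D)
    {x : ℝ} (hx : ContinuousAt g x) (μ : ℝ) :
    Tendsto (fun t => ∫ y, g y * ((1 / Real.sqrt t) * phi ((x - y + μ * t) / Real.sqrt t)))
      (nhdsWithin 0 (Ioi 0)) (nhds (g x)) := by
  have hlim : Tendsto (fun t => ∫ z, g (x + μ * t + Real.sqrt t * z) * phi z)
      (nhdsWithin 0 (Ioi 0)) (nhds (∫ z, g x * phi z)) := by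
    refine tendsto_integral_filter_of_dominated_convergence (fun z => D * phi z)
      (Eventually.of_forall fun t => ((hg.comp (by fun_prop)).mul
        continuous_phi.measurable).aestronglyMeasurable)
      (Eventually.of_forall fun t => ae_of_all _ fun z => ?_)
      (integrable_phi.const_mul D) (ae_of_all _ fun z => ?_)
    · rw [norm_mul, Real.norm_eq_abs, Real.norm_of_nonneg (phi_nonneg z)]
      exact mul_le_mul_of_nonneg_right (hD _) (phi_nonneg z)
    · have h1 : Tendsto (fun t => x + μ * t + Real.sqrt t * z) (nhdsWithin 0 (Ioi 0))
          (nhds x) := by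
        have : Continuous fun t => x + μ * t + Real.sqrt t * z := by fun_prop
        simpa using (this.tendsto 0).mono_left nhdsWithin_le_nhds
      exact (hx.tendsto.comp h1).mul_const _
  rw [integral_const_mul, integral_phi, mul_one] at hlim
  refine hlim.congr' ?_
  filter_upwards [self_mem_nhdsWithin] with t ht
  have hs := Real.sqrt_pos.2 ht
  set s := Real.sqrt t
  set F : ℝ → ℝ := fun y => g y * ((1 / s) * phi ((x - y + μ * t) / s)) with hF
  have h2 := Measure.integral_comp_mul_left (fun w => F (x + μ * t + w)) s
  rw [integral_add_left_eq_self F, abs_of_pos (inv_pos.2 hs), smul_eq_mul] at h2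
  rw [← mul_inv_cancel_left₀ hs.ne' (∫ y, F y), ← h2, ← integral_const_mul]
  congr 1
  funext z
  have h3 : (x - (x + μ * t + s * z) + μ * t) / s = -z := by
    field_simp
    ring
  simp only [hF, h3, phi_neg]
  field_simp

lemma exp_mul_phi_reflect (μ : ℝ) {t : ℝ} (ht : 0 < t) (x y : ℝ) :
    Real.exp (2 * μ * y) * phi ((x + y + μ * t) / Real.sqrt t) =
      Real.exp (-2 * μ * x) * phi ((-x - y + μ * t) / Real.sqrt t) := by
  simp only [phi, mul_left_comm (Real.exp _), ← Real.exp_add, div_pow, neg_div,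
    Real.sq_sqrt ht.le]
  congr 2
  field_simp
  ring

/-- The killed semigroup is an approximate identity at interior points. -/
lemma tendsto_integral_mul_killedKer {h : ℝ → ℝ} (hc : ContinuousOn h (Ici 0)) {D : ℝ}
    (hD : ∀ y ∈ Ici (0 : ℝ), |h y| ≤ D) (μ : ℝ) {x : ℝ} (hx : 0 < x) :
    Tendsto (fun t => ∫ y in Ioi 0, h y * killedKer μ t x y) (nhdsWithin 0 (Ioi 0))
      (nhds (h x)) := by
  set g := (Ioi (0 : ℝ)).indicator h with hg
  have hgm : Measurable g := by
    have hm := (hc.mono Ioi_subset_Ici_self).measurable_piecewise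
      (continuousOn_const (c := (0 : ℝ)) (s := (Ioi (0 : ℝ))ᶜ)) measurableSet_Ioi
    convert hm using 1
    exact (piecewise_eq_indicator).symm
  have hgD : ∀ y, |g y| ≤ D := fun y => by
    by_cases hy : y ∈ Ioi (0 : ℝ)
    · rw [hg, indicator_of_mem hy]
      exact hD y (Ioi_subset_Ici_self hy)
    · rw [hg, indicator_of_notMem hy, abs_zero]
      exact (abs_nonneg _).trans (hD 0 self_mem_Ici)
  have hgx : g =ᶠ[nhds x] h := by
    filter_upwards [Ioi_mem_nhds hx] with y hy using indicator_of_mem hy h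
  have hgnx : g =ᶠ[nhds (-x)] fun _ => 0 := by
    filter_upwards [Iio_mem_nhds (neg_neg_of_pos hx)] with y hy
    exact indicator_of_notMem (not_lt.2 (le_of_lt hy)) h
  have h1 := tendsto_integral_gaussian hgm hgD
    ((hc.continuousAt (Ici_mem_nhds hx)).congr hgx.symm) μ
  have h2 := (tendsto_integral_gaussian hgm hgD
    (continuousAt_const.congr hgnx.symm) μ).const_mul (Real.exp (-2 * μ * x))
  have h3 := h1.sub h2
  rw [hgx.eq_of_nhds, hgnx.eq_of_nhds, mul_zero, sub_zero] at h3
  refine h3.congr' ?_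
  filter_upwards [self_mem_nhdsWithin] with t ht
  have hs := Real.sqrt_pos.2 ht
  have hint : ∀ a : ℝ, Integrable fun y =>
      g y * ((1 / Real.sqrt t) * phi ((a - y + μ * t) / Real.sqrt t)) := fun a => by
    have h4 : Integrable fun y => phi ((a - y + μ * t) / Real.sqrt t) := by
      have := ((integrable_phi.comp_div hs.ne').comp_sub_left (a + μ * t))
      refine this.congr (ae_of_all _ fun y => ?_)
      simp only
      congr 2
      ring
    exact (h4.const_mul _).bdd_mul hgm.aestronglyMeasurable (ae_of_all _ hgD)
  rw [← integral_const_mul, ← integral_sub (hint x) ((hint (-x)).const_mul _),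
    ← integral_indicator measurableSet_Ioi]
  congr 1
  funext y
  rw [indicator_mul_left, killedKer, exp_mul_phi_reflect μ ht]
  ring

/-- the spatial derivative of `u¹` converges to `f'(x)` as
`t ↓ 0`, for every `x > 0`. -/
theorem u1_derivative_initial_limit (μ : ℝ) (f : ℝ → ℝ) (hf : IsInitialData f) :
    ∀ x > (0 : ℝ),
      Filter.Tendsto
        (fun t => derivWithin
          (fun x' => ∫ y in Set.Ioi (0 : ℝ), f y * Gker μ t x' y) (Set.Ici 0) x)
        (nhdsWithin 0 (Set.Ioi 0)) (nhds (derivWithin f (Set.Ici 0) x)) := by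
  intro x hx
  obtain ⟨hC1, ⟨D, hD⟩, h0⟩ := hf
  have hgc : ContinuousOn (derivWithin f (Ici 0)) (Ici 0) :=
    hC1.continuousOn_derivWithin (uniqueDiffOn_Ici 0) le_rfl
  have hfg : ∀ y ∈ Ioi (0 : ℝ), HasDerivAt f (derivWithin f (Ici 0) y) y := fun y hy =>
    ((hC1.differentiableOn one_ne_zero y (Ioi_subset_Ici_self hy)).hasDerivWithinAt).hasDerivAt
      (Ici_mem_nhds hy)
  have hg : ∀ y ∈ Ici (0 : ℝ), |derivWithin f (Ici 0) y| ≤ D := fun y hy => (hD y hy).2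
  refine (tendsto_integral_mul_killedKer hgc hg μ hx).congr' ?_
  filter_upwards [self_mem_nhdsWithin] with t ht
  simp only [integral_mul_Gker hC1.continuousOn hgc hfg (fun y hy => (hD y hy).1) hg h0 μ ht]
  exact (((hasDerivAt_integral_mul_survG hgc hg μ ht x).const_add
    (f 0)).hasDerivWithinAt.derivWithin (uniqueDiffOn_Ici 0 x hx.le)).symm
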